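/- Assume R is Artinian and H⁺ has a dominating element. Then for every R[H⁺]-module J which is finitely generated as an R-module, J decomposes as the internal direct sum J = J_fsu ⊕ J_nil of H⁺-stable R-submodules. -/

import Mathlib

/-- A submodule `N` of an `R[H⁺]`-module `(J, ρ)` is an `H⁺`-stable submodule which is finitely
surjective for the restricted action. -/
def IsFinSurjSub (R : Type*) [CommRing R] {H : Type*} [CommMonoid H]
    {J : Type*} [AddCommGroup J] [Module R J] (ρ : H → Module.End R J)
    (N : Submodule R J) : Prop :=
  N.FG ∧ (∀ t : H, ∀ x ∈ N, ρ t x ∈ N) ∧ (∀ t : H, ∀ x ∈ N, ∃ y ∈ N, ρ t y = x)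

/-- The finitely surjective part `J_fsu` of an `R[H⁺]`-module: the sum of all `H⁺`-stable
`R`-submodules of `J` that are finitely surjective for the restricted action. -/
def fsuPart (R : Type*) [CommRing R] {H : Type*} [CommMonoid H]
    (J : Type*) [AddCommGroup J] [Module R J] (ρ : H → Module.End R J) : Submodule R J :=
  sSup {N | IsFinSurjSub R ρ N}

/-- An element `tp` of a commutative monoid `H⁺` is dominating if for every `t ∈ H⁺` one has
`tp ^ k ∈ t · H⁺` for all sufficiently large `k`. -/
def Dominating {H : Type*} [CommMonoid H] (tp : H) : Prop :=
  ∀ t : H, ∃ K : ℕ, ∀ k ≥ K, ∃ s : H, tp ^ k = t * s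

/-- The nilpotent part `J_nil = {x ∈ J : t·x = 0 for some t ∈ H⁺}` of an `R[H⁺]`-module,
as an `R`-submodule of `J`. -/
def nilSub (R : Type*) [CommRing R] {H : Type*} [CommMonoid H]
    (J : Type*) [AddCommGroup J] [Module R J] (ρ : H →* Module.End R J) : Submodule R J where
  carrier := {x | ∃ t : H, ρ t x = 0}
  zero_mem' := ⟨1, map_zero _⟩
  add_mem' := by
    rintro x y ⟨t, ht⟩ ⟨s, hs⟩
    refine ⟨t * s, ?_⟩
    have h1 : ρ (t * s) x = ρ s (ρ t x) := by
      rw [mul_comm, map_mul]; rfl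
    have h2 : ρ (t * s) y = ρ t (ρ s y) := by
      rw [map_mul]; rfl
    rw [map_add, h1, h2, ht, hs, map_zero, map_zero, add_zero]
  smul_mem' := by
    rintro c x ⟨t, ht⟩
    exact ⟨t, by rw [map_smul, ht, smul_zero]⟩

/-- The nilpotent part is the generalized kernel of a dominating element. -/
theorem nilSub_eq_iSup_ker_pow (R : Type*) [CommRing R] {H : Type*} [CommMonoid H]
    (J : Type*) [AddCommGroup J] [Module R J] (ρ : H →* Module.End R J)
    {tp : H} (htp : Dominating tp) :
    nilSub R J ρ = ⨆ n : ℕ, LinearMap.ker (ρ tp ^ n) := by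
  apply le_antisymm
  · rintro x ⟨t, ht⟩
    obtain ⟨K, hK⟩ := htp t
    obtain ⟨s, hs⟩ := hK K le_rfl
    refine Submodule.mem_iSup_of_mem K ?_
    rw [LinearMap.mem_ker, ← map_pow, hs, mul_comm, map_mul, Module.End.mul_apply, ht, map_zero]
  · refine iSup_le fun n x hx => ⟨tp ^ n, ?_⟩
    rwa [map_pow]

/-- A finitely surjective submodule lies in the range of every operator. -/
theorem IsFinSurjSub.le_range {R : Type*} [CommRing R] {H : Type*} [CommMonoid H]
    {J : Type*} [AddCommGroup J] [Module R J] {ρ : H → Module.End R J}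
    {N : Submodule R J} (hN : IsFinSurjSub R ρ N) (t : H) : N ≤ LinearMap.range (ρ t) := by
  intro x hx
  obtain ⟨y, -, hy⟩ := hN.2.2 t x hx
  exact ⟨y, hy⟩

/-- The stable range of a dominating element is finitely surjective. -/
theorem isFinSurjSub_iInf_range_pow {R : Type*} [CommRing R] {H : Type*} [CommMonoid H]
    {J : Type*} [AddCommGroup J] [Module R J] [IsNoetherian R J] [IsArtinian R J]
    (ρ : H →* Module.End R J) {tp : H} (htp : Dominating tp) :
    IsFinSurjSub R ρ (⨅ n : ℕ, LinearMap.range (ρ tp ^ n)) := by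
  have comm (t : H) (n : ℕ) (z : J) : ρ t ((ρ tp ^ n) z) = (ρ tp ^ n) (ρ t z) := by
    rw [← map_pow, ← Module.End.mul_apply, ← map_mul, mul_comm, map_mul, Module.End.mul_apply]
  refine ⟨IsNoetherian.noetherian _, fun t x hx => ?_, fun t x hx => ?_⟩
  · rw [Submodule.mem_iInf] at hx ⊢
    intro n
    obtain ⟨z, rfl⟩ := hx n
    exact ⟨ρ t z, (comm t n z).symm⟩
  · obtain ⟨m, hm⟩ := (ρ tp).eventually_iInf_range_pow_eq.exists
    obtain ⟨K, hK⟩ := htp t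
    obtain ⟨s, hs⟩ := hK K le_rfl
    obtain ⟨z, rfl⟩ := (Submodule.mem_iInf _).mp hx (K + m)
    refine ⟨(ρ tp ^ m) (ρ s z), hm ▸ LinearMap.mem_range_self _ _, ?_⟩
    rw [← comm s, ← Module.End.mul_apply, ← map_mul, ← hs, map_pow, pow_add, Module.End.mul_apply]

/-- The finitely surjective part is the stable range of a dominating element. -/
theorem fsuPart_eq_iInf_range_pow (R : Type*) [CommRing R] {H : Type*} [CommMonoid H]
    (J : Type*) [AddCommGroup J] [Module R J] [IsNoetherian R J] [IsArtinian R J]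
    (ρ : H →* Module.End R J) {tp : H} (htp : Dominating tp) :
    fsuPart R J ρ = ⨅ n : ℕ, LinearMap.range (ρ tp ^ n) := by
  refine le_antisymm (sSup_le fun N hN => le_iInf fun n => ?_)
    (le_sSup (isFinSurjSub_iInf_range_pow ρ htp))
  rw [← map_pow]
  exact IsFinSurjSub.le_range hN _

/-- Assume `R` is Artinian and the commutative monoid `H⁺` has a dominating element.  Then every
`R[H⁺]`-module `J` which is finitely generated as an `R`-module decomposes as the internal direct
sum `J = J_fsu ⊕ J_nil` of `H⁺`-stable `R`-submodules. -/
theorem fsu_nil_decomposition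
    (R : Type*) [CommRing R] [IsNoetherianRing R] [IsArtinianRing R]
    {H : Type*} [CommMonoid H]
    (J : Type*) [AddCommGroup J] [Module R J] [Module.Finite R J]
    (ρ : H →* Module.End R J) (hdom : ∃ tp : H, Dominating tp) :
    (∀ t : H, ∀ x ∈ fsuPart R J ⇑ρ, ρ t x ∈ fsuPart R J ⇑ρ) ∧
    (∀ t : H, ∀ x ∈ nilSub R J ρ, ρ t x ∈ nilSub R J ρ) ∧
    IsCompl (fsuPart R J ⇑ρ) (nilSub R J ρ) := by
  obtain ⟨tp, htp⟩ := hdom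
  refine ⟨?_, ?_, ?_⟩
  · rw [fsuPart_eq_iInf_range_pow R J ρ htp]
    exact (isFinSurjSub_iInf_range_pow ρ htp).2.1
  · rintro t x ⟨s, hs⟩
    refine ⟨s, ?_⟩
    rw [← Module.End.mul_apply, ← map_mul, mul_comm, map_mul, Module.End.mul_apply, hs, map_zero]
  · rw [fsuPart_eq_iInf_range_pow R J ρ htp, nilSub_eq_iSup_ker_pow R J ρ htp]
    exact ((ρ tp).isCompl_iSup_ker_pow_iInf_range_pow).symm
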